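/- Suppose demand is symmetric, θ_i = θ > 0 for all i ∈ L, and 0 < I < W. If an optimal tuple for the platform's problem exists, then there exists an optimal tuple (p, f, x, y) that additionally satisfies the IC constraint x_τ^τ ≥ x_i^τ for all i, τ ∈ L. Consequently, the maximum of R over feasible tuples satisfying the IC constraint equals the maximum of R over all feasible tuples (i.e., imposing the IC constraint causes no loss of revenue, so PARM achieves the full-information first-best revenue). -/

import Mathlib

open Finset

/-- Feasibility of a tuple `(p, f, x, y)` for the platform's problem:
prices in `[0,1]`, nonnegativity, flow balance, full dispatch,
market clearing, and the supply constraint. -/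
def Feasible {L : Type*} [Fintype L] (θ : L → ℝ) (α : L → L → ℝ) (s : L → ℝ)
    (p : L → L → ℝ) (f : L → L → L → ℝ) (x : L → L → ℝ) (y : L → L → L → ℝ) : Prop :=
  (∀ i j, 0 ≤ p i j ∧ p i j ≤ 1) ∧
  (∀ i j τ, 0 ≤ f i j τ) ∧ (∀ i j τ, 0 ≤ y i j τ) ∧ (∀ i τ, 0 ≤ x i τ) ∧
  (∀ i τ, x i τ = ∑ j, (f j i τ + y j i τ)) ∧
  (∀ i τ, (∑ j, (f i j τ + y i j τ)) = x i τ) ∧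
  (∀ i j, (∑ τ, f i j τ) = θ i * α i j * (1 - p i j)) ∧
  (∀ τ, (∑ i, x i τ) ≤ s τ)

/-- The platform's revenue objective. -/
noncomputable def Revenue {L : Type*} [Fintype L] (W I : ℝ)
    (p : L → L → ℝ) (f : L → L → L → ℝ) (x : L → L → ℝ) : ℝ :=
  (∑ i, ∑ j, ∑ τ, f i j τ * p i j) - W * (∑ i, ∑ τ, x i τ) + I * (∑ τ, x τ τ)

noncomputable def phiA (c G : ℝ) : ℝ := c / 4 - (max (c / 2 - G) 0) ^ 2 / c

lemma phiA_ge (c q G : ℝ) (hc : 0 < c) (hqG : q ≤ G) :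
    q * (1 - q / c) ≤ phiA c G := by
  have h1 : (max (c / 2 - G) 0) ^ 2 ≤ (c / 2 - q) ^ 2 := by
    rcases le_total (c / 2 - G) 0 with h | h
    · rw [max_eq_right h]; nlinarith [sq_nonneg (c / 2 - q)]
    · rw [max_eq_left h]; nlinarith
  have h2 : q * (1 - q / c) = c / 4 - (c / 2 - q) ^ 2 / c := by field_simp; ring
  rw [h2]; unfold phiA
  have := div_le_div_of_nonneg_right h1 hc.le
  linarith

lemma phiA_eq (c G : ℝ) (hc : 0 < c) :
    phiA c G = min G (c / 2) * (1 - min G (c / 2) / c) := by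
  unfold phiA
  rcases le_total G (c / 2) with h | h
  · rw [min_eq_left h, max_eq_left (by linarith)]; field_simp; ring
  · rw [min_eq_right h, max_eq_right (by linarith)]; field_simp; ring

lemma phiA_exch (c a b T : ℝ) (hc : 0 < c) (hT : 0 ≤ T) (hTb : T ≤ b - a) :
    phiA c a + phiA c b ≤ phiA c (a + T) + phiA c (b - T) := by
  unfold phiA
  have key : (max (c / 2 - (a + T)) 0) ^ 2 + (max (c / 2 - (b - T)) 0) ^ 2
      ≤ (max (c / 2 - a) 0) ^ 2 + (max (c / 2 - b) 0) ^ 2 := by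
    have e1 : max (c / 2 - (a + T)) 0 ≤ max (c / 2 - a) 0 := by gcongr; linarith
    have e2 : max (c / 2 - b) 0 ≤ max (c / 2 - (a + T)) 0 := by gcongr; linarith
    have e3 : max (c / 2 - (b - T)) 0 ≤ max (c / 2 - a) 0 := by gcongr; linarith
    have e4 : max (c / 2 - b) 0 ≤ max (c / 2 - (b - T)) 0 := by gcongr; linarith
    have e5 : max (c / 2 - (a + T)) 0 + max (c / 2 - (b - T)) 0
        ≤ max (c / 2 - a) 0 + max (c / 2 - b) 0 := by
      rcases max_cases (c / 2 - (a + T)) 0 with h1 | h1 <;>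
      rcases max_cases (c / 2 - (b - T)) 0 with h2 | h2 <;>
      rcases max_cases (c / 2 - a) 0 with h3 | h3 <;>
      rcases max_cases (c / 2 - b) 0 with h4 | h4 <;> linarith [h1.1, h2.1, h3.1, h4.1]
    have e6 : 0 ≤ max (c / 2 - b) 0 := le_max_right _ _
    generalize max (c / 2 - (a + T)) 0 = u' at *
    generalize max (c / 2 - (b - T)) 0 = v' at *
    generalize max (c / 2 - a) 0 = u at *
    generalize max (c / 2 - b) 0 = v at *
    nlinarith [mul_nonneg (sub_nonneg.2 e1) (sub_nonneg.2 e2),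
      mul_nonneg (sub_nonneg.2 e3) (sub_nonneg.2 e4),
      mul_nonneg (sub_nonneg.2 e5) (by linarith : 0 ≤ u + v)]
  have := div_le_div_of_nonneg_right key hc.le
  rw [add_div, add_div] at this
  linarith

lemma phiA_mid (c a b : ℝ) (hc : 0 < c) :
    phiA c a + phiA c b ≤ 2 * phiA c ((a + b) / 2) := by
  rcases le_total a b with h | h
  · have := phiA_exch c a b ((b - a) / 2) hc (by linarith) (by linarith)
    rw [show a + (b - a) / 2 = (a + b) / 2 by ring,
      show b - (b - a) / 2 = (a + b) / 2 by ring] at this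
    linarith
  · have := phiA_exch c b a ((a - b) / 2) hc (by linarith) (by linarith)
    rw [show b + (a - b) / 2 = (a + b) / 2 by ring,
      show a - (a - b) / 2 = (a + b) / 2 by ring] at this
    linarith

/-- Value of a total flow `g`. -/
noncomputable def ValA {L : Type*} [Fintype L] (c W I : ℝ) (g : L → L → L → ℝ) : ℝ :=
  (∑ i, ∑ j, phiA c (∑ τ, g i j τ)) - W * (∑ i, ∑ τ, ∑ j, g i j τ) + I * (∑ τ, ∑ j, g τ j τ)

/-- Admissible symmetric total flows. -/
def AdmA {L : Type*} [Fintype L] (s : L → ℝ) (g : L → L → L → ℝ) : Prop :=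
  (∀ i j τ, 0 ≤ g i j τ) ∧ (∀ i j τ, g i j τ = g j i τ) ∧ (∀ τ, ∑ i, ∑ j, g i j τ ≤ s τ)

lemma constructA {L : Type*} [Fintype L] (θfun : L → ℝ) (α : L → L → ℝ) (s : L → ℝ)
    (W I c : ℝ) (hc : 0 < c) (hca : ∀ i j, θfun i * α i j = c)
    (g : L → L → L → ℝ) (hg : AdmA s g) :
    ∃ p f y, Feasible θfun α s p f (fun i τ => ∑ j, g i j τ) y ∧
      Revenue W I p f (fun i τ => ∑ j, g i j τ) = ValA c W I g := by
  obtain ⟨h0, hsy, hsup⟩ := hg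
  have hG0 : ∀ i j, 0 ≤ ∑ τ, g i j τ := fun i j => sum_nonneg fun τ _ => h0 i j τ
  let q : L → L → ℝ := fun i j => min (∑ τ, g i j τ) (c / 2)
  have hq0 : ∀ i j, 0 ≤ q i j := fun i j => le_min (hG0 i j) (by linarith)
  have hqc : ∀ i j, q i j ≤ c / 2 := fun i j => min_le_right _ _
  have hqG : ∀ i j, q i j ≤ ∑ τ, g i j τ := fun i j => min_le_left _ _
  let r : L → L → ℝ := fun i j => q i j / ∑ τ, g i j τ
  have hr0 : ∀ i j, 0 ≤ r i j := fun i j => div_nonneg (hq0 i j) (hG0 i j)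
  have hr1 : ∀ i j, r i j ≤ 1 := fun i j => div_le_one_of_le₀ (hqG i j) (hG0 i j)
  have hf : ∀ i j, ∑ τ, g i j τ * r i j = q i j := by
    intro i j
    rw [← sum_mul]
    by_cases h : ∑ τ, g i j τ = 0
    · have h1 := hqG i j
      have h2 := hq0 i j
      rw [h] at h1 ⊢
      linarith
    · exact mul_div_cancel₀ _ h
  refine ⟨fun i j => 1 - q i j / c, fun i j τ => g i j τ * r i j,
    fun i j τ => g i j τ - g i j τ * r i j, ⟨?_, ?_, ?_, ?_, ?_, ?_, ?_, ?_⟩, ?_⟩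
  · intro i j
    have h1 : 0 ≤ q i j / c := div_nonneg (hq0 i j) hc.le
    have h2 : q i j / c ≤ 1 := div_le_one_of_le₀ (by linarith [hqc i j]) hc.le
    constructor <;> linarith
  · intro i j τ; exact mul_nonneg (h0 i j τ) (hr0 i j)
  · intro i j τ
    have := mul_le_mul_of_nonneg_left (hr1 i j) (h0 i j τ)
    simp only
    linarith
  · intro i τ; exact sum_nonneg fun j _ => h0 i j τ
  · intro i τ
    refine sum_congr rfl fun j _ => ?_
    rw [hsy i j]; ring
  · intro i τ
    refine sum_congr rfl fun j _ => ?_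
    ring
  · intro i j
    rw [hca]
    simp only [hf]
    field_simp
    ring
  · exact hsup
  · unfold Revenue ValA
    congr 2
    refine sum_congr rfl fun i _ => sum_congr rfl fun j _ => ?_
    rw [← sum_mul, hf, phiA_eq c _ hc]

lemma symmA {L : Type*} [Fintype L] (θfun : L → ℝ) (α : L → L → ℝ) (s : L → ℝ)
    (W I c : ℝ) (hc : 0 < c) (hca : ∀ i j, θfun i * α i j = c)
    (p : L → L → ℝ) (f : L → L → L → ℝ) (x : L → L → ℝ) (y : L → L → L → ℝ)
    (hF : Feasible θfun α s p f x y) :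
    ∃ g, AdmA s g ∧ Revenue W I p f x ≤ ValA c W I g := by
  obtain ⟨-, hf, hy, -, hin, hout, hmc, hsup⟩ := hF
  let k : L → L → L → ℝ := fun i j τ => f i j τ + y i j τ
  have hk0 : ∀ i j τ, 0 ≤ k i j τ := fun i j τ => add_nonneg (hf i j τ) (hy i j τ)
  let g : L → L → L → ℝ := fun i j τ => (k i j τ + k j i τ) / 2
  have hx : ∀ i τ, ∑ j, g i j τ = x i τ := by
    intro i τ
    have h1 : ∑ j, k i j τ = x i τ := hout i τ
    have h2 : ∑ j, k j i τ = x i τ := (hin i τ).symm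
    simp only [g]
    rw [← sum_div, sum_add_distrib, h1, h2]; ring
  refine ⟨g, ⟨?_, ?_, ?_⟩, ?_⟩
  · intro i j τ
    have := hk0 i j τ
    have := hk0 j i τ
    simp only [g]; linarith
  · intro i j τ; simp only [g]; ring
  · intro τ; simp only [hx]; exact hsup τ
  · unfold Revenue ValA
    simp only [hx]
    gcongr ?_ - _ + _
    have h1 : ∀ i j, ∑ τ, f i j τ * p i j ≤ phiA c (∑ τ, k i j τ) := by
      intro i j
      have hq := hmc i j
      rw [hca] at hq
      rw [← sum_mul]
      have hp : p i j = 1 - (∑ τ, f i j τ) / c := by rw [hq]; field_simp; ring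
      rw [hp]
      exact phiA_ge c _ _ hc (sum_le_sum fun τ _ => le_add_of_nonneg_right (hy i j τ))
    have h2 : ∑ i, ∑ j, ∑ τ, f i j τ * p i j ≤ ∑ i, ∑ j, phiA c (∑ τ, k i j τ) :=
      sum_le_sum fun i _ => sum_le_sum fun j _ => h1 i j
    have h3 : ∑ i, ∑ j, phiA c (∑ τ, k i j τ) = ∑ i, ∑ j, phiA c (∑ τ, k j i τ) := sum_comm
    have h4 : ∑ i, ∑ j, (phiA c (∑ τ, k i j τ) + phiA c (∑ τ, k j i τ))
        ≤ ∑ i, ∑ j, 2 * phiA c (∑ τ, g i j τ) := by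
      refine sum_le_sum fun i _ => sum_le_sum fun j _ => ?_
      have := phiA_mid c (∑ τ, k i j τ) (∑ τ, k j i τ) hc
      rw [← sum_add_distrib, sum_div] at this
      exact this
    simp only [sum_add_distrib, ← mul_sum] at h4
    linarith

lemma sum_swap2 {L : Type*} [Fintype L] (π : Equiv.Perm L) (F : L → L → ℝ) :
    ∑ i, ∑ j, F (π i) (π j) = ∑ i, ∑ j, F i j := by
  rw [Equiv.sum_comp π (fun i => ∑ j, F i (π j))]
  exact sum_congr rfl fun i _ => Equiv.sum_comp π (fun j => F i j)

/-- The basic perturbation. -/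
lemma perturbA {L : Type*} [Fintype L] [DecidableEq L] (s : L → ℝ) (c W I : ℝ)
    (hc : 0 < c) (hI : 0 < I) (g : L → L → L → ℝ) (hg : AdmA s g) (k τ j : L)
    (hkτ : k ≠ τ) (hjτ : j ≠ τ) (t : L → ℝ)
    (ht1 : ∀ σ, t σ ≤ g k j σ) (ht2 : ∀ σ, - g τ (Equiv.swap k τ j) σ ≤ t σ)
    (hT0 : 0 ≤ ∑ σ, t σ)
    (hT : ∑ σ, t σ = 0 ∨ ∑ σ, t σ ≤ ∑ σ, g k j σ - ∑ σ, g τ (Equiv.swap k τ j) σ)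
    (hgain : t k < t τ) :
    ∃ g', AdmA s g' ∧ ValA c W I g < ValA c W I g' := by
  obtain ⟨h0, hsy, hsup⟩ := hg
  set π := Equiv.swap k τ with hπ
  have hππ : ∀ i, π (π i) = i := fun i => Equiv.swap_apply_self k τ i
  have hπk : π k = τ := Equiv.swap_apply_left k τ
  have hπτ : π τ = k := Equiv.swap_apply_right k τ
  let w : L → L → ℝ := fun a b => if (a = k ∧ b = j) ∨ (a = j ∧ b = k) then 1 else 0
  have hwsy : ∀ a b, w a b = w b a := by
    intro a b; simp only [w]; congr 1; apply propext; tauto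
  have hw : ∀ a b, (w a b = 0) ∨ (w a b = 1 ∧ w (π a) (π b) = 0 ∧
      ((a = k ∧ b = j) ∨ (a = j ∧ b = k))) := by
    intro a b
    by_cases h : (a = k ∧ b = j) ∨ (a = j ∧ b = k)
    · right
      refine ⟨if_pos h, if_neg ?_, h⟩
      rcases h with ⟨rfl, rfl⟩ | ⟨rfl, rfl⟩
      · rw [hπk]; rintro (⟨h, -⟩ | ⟨h, -⟩)
        · exact hkτ h.symm
        · exact hjτ h.symm
      · rw [hπk]; rintro (⟨-, h⟩ | ⟨-, h⟩)
        · exact hjτ h.symm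
        · exact hkτ h.symm
    · left; exact if_neg h
  let T := ∑ σ, t σ
  let g' : L → L → L → ℝ := fun a b σ => g a b σ + t σ * (w (π a) (π b) - w a b)
  have hsum0 : ∑ a, ∑ b, (w (π a) (π b) - w a b) = 0 := by
    simp only [sum_sub_distrib]
    rw [sum_swap2 π w]; ring
  have htot : ∀ σ, ∑ a, ∑ b, g' a b σ = ∑ a, ∑ b, g a b σ := by
    intro σ
    simp only [g', sum_add_distrib, ← mul_sum]
    rw [hsum0]; ring
  have hG' : ∀ a b, ∑ σ, g' a b σ = ∑ σ, g a b σ + T * (w (π a) (π b) - w a b) := by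
    intro a b
    simp only [g', sum_add_distrib, ← sum_mul, T]
  refine ⟨g', ⟨?_, ?_, ?_⟩, ?_⟩
  · intro a b σ
    simp only [g']
    rcases hw a b with h | ⟨h1, h2, h3⟩
    · rcases hw (π a) (π b) with h' | ⟨h1', -, h3'⟩
      · rw [h, h']; have := h0 a b σ; linarith
      · rw [h, h1']
        have h5 : g a b σ = g τ (π j) σ := by
          rcases h3' with ⟨ha, hb⟩ | ⟨ha, hb⟩
          · rw [← hb, hππ, ← hπk, ← ha, hππ]
          · rw [← ha, hππ, ← hπk, ← hb, hππ, hsy]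
        have := ht2 σ
        linarith
    · rw [h1, h2]
      have h5 : g a b σ = g k j σ := by
        rcases h3 with ⟨rfl, rfl⟩ | ⟨rfl, rfl⟩
        · rfl
        · exact hsy _ _ _
      have := ht1 σ
      linarith
  · intro a b σ
    simp only [g']
    rw [hsy a b, hwsy a b, hwsy (π a) (π b)]
  · intro σ; rw [htot]; exact hsup σ
  · have hphi : ∑ a, ∑ b, phiA c (∑ σ, g a b σ) ≤ ∑ a, ∑ b, phiA c (∑ σ, g' a b σ) := by
      have e1 := sum_swap2 π (fun a b => phiA c (∑ σ, g a b σ))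
      have e2 := sum_swap2 π (fun a b => phiA c (∑ σ, g' a b σ))
      have base : ∀ a b, w a b = 1 → w (π a) (π b) = 0 → ((a = k ∧ b = j) ∨ (a = j ∧ b = k)) →
          phiA c (∑ σ, g a b σ) + phiA c (∑ σ, g (π a) (π b) σ) ≤
          phiA c (∑ σ, g a b σ - T) + phiA c (∑ σ, g (π a) (π b) σ + T) := by
        intro a b h1 h2 h3
        rcases hT with hT | hT
        · have : T = 0 := hT
          rw [this]; simp
        · have h5 : ∀ σ, g a b σ = g k j σ := by
            intro σ
            rcases h3 with ⟨rfl, rfl⟩ | ⟨rfl, rfl⟩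
            · rfl
            · exact hsy _ _ _
          have h6 : ∀ σ, g (π a) (π b) σ = g τ (π j) σ := by
            intro σ
            rcases h3 with ⟨ha, hb⟩ | ⟨ha, hb⟩
            · rw [ha, hb, hπk]
            · rw [ha, hb, hπk, hsy]
          simp only [h5, h6]
          have := phiA_exch c (∑ σ, g τ (π j) σ) (∑ σ, g k j σ) T hc hT0 hT
          linarith
      have e3 : ∑ a, ∑ b, (phiA c (∑ σ, g a b σ) + phiA c (∑ σ, g (π a) (π b) σ)) ≤
          ∑ a, ∑ b, (phiA c (∑ σ, g' a b σ) + phiA c (∑ σ, g' (π a) (π b) σ)) := by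
        refine sum_le_sum fun a _ => sum_le_sum fun b _ => ?_
        rw [hG', hG', hππ, hππ]
        rcases hw a b with h | ⟨h1, h2, h3⟩
        · rcases hw (π a) (π b) with h' | ⟨h1', h2', h3'⟩
          · rw [h, h']; simp
          · have := base _ _ h1' h2' h3'
            rw [hππ, hππ] at this
            rw [h, h1']
            simp only [sub_zero, zero_sub, mul_one, mul_neg, ← sub_eq_add_neg]
            linarith
        · have := base _ _ h1 h2 h3
          rw [h1, h2]
          simp only [sub_zero, zero_sub, mul_one, mul_neg, ← sub_eq_add_neg]
          linarith
      simp only [sum_add_distrib] at e3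
      linarith
    have hW : ∑ i, ∑ σ, ∑ b, g' i b σ = ∑ i, ∑ σ, ∑ b, g i b σ := by
      rw [sum_comm, sum_comm (f := fun i σ => ∑ b, g i b σ)]
      exact sum_congr rfl fun σ _ => htot σ
    let r : L → ℝ := fun a => ∑ b, w a b
    have hw0 : ∀ a b, 0 ≤ w a b := by
      intro a b; simp only [w]; split_ifs <;> norm_num
    have hrk : 0 < r k := by
      have h1 : w k j ≤ r k := single_le_sum (fun b _ => hw0 k b) (mem_univ j)
      have h2 : w k j = 1 := if_pos (Or.inl ⟨rfl, rfl⟩)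
      linarith
    have hrτ : r τ = 0 := by
      refine sum_eq_zero fun b _ => if_neg ?_
      rintro (⟨h, -⟩ | ⟨h, -⟩)
      · exact hkτ h.symm
      · exact hjτ h.symm
    have hB : ∑ σ, ∑ b, g' σ b σ = ∑ σ, ∑ b, g σ b σ + ∑ σ, t σ * (r (π σ) - r σ) := by
      rw [← sum_add_distrib]
      refine sum_congr rfl fun σ _ => ?_
      simp only [g', sum_add_distrib, ← mul_sum, sum_sub_distrib]
      rw [Equiv.sum_comp π (fun b => w (π σ) b)]
    have hB2 : ∑ σ, t σ * (r (π σ) - r σ) = r k * (t τ - t k) := by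
      rw [← sum_subset (subset_univ {k, τ}), sum_pair hkτ, hπk, hπτ, hrτ]
      · ring
      · intro σ _ h
        simp only [mem_insert, mem_singleton, not_or] at h
        rw [hπ, Equiv.swap_apply_of_ne_of_ne h.1 h.2]; ring
    have hpos : 0 < I * (r k * (t τ - t k)) :=
      mul_pos hI (mul_pos hrk (by linarith))
    unfold ValA
    rw [hW, hB, hB2, mul_add]
    linarith

lemma improveA {L : Type*} [Fintype L] (s : L → ℝ) (c W I : ℝ)
    (hc : 0 < c) (hI : 0 < I) (g : L → L → L → ℝ) (hg : AdmA s g) (k τ : L)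
    (hv : ∑ j, g τ j τ < ∑ j, g k j τ) :
    ∃ g', AdmA s g' ∧ ValA c W I g < ValA c W I g' := by
  classical
  have hkτ : k ≠ τ := by rintro rfl; exact lt_irrefl _ hv
  rw [← Equiv.sum_comp (Equiv.swap k τ) (fun j => g τ j τ)] at hv
  obtain ⟨j, -, hj⟩ := exists_lt_of_sum_lt hv
  have hjτ : j ≠ τ := by
    rintro rfl
    rw [Equiv.swap_apply_right, hg.2.1 j k] at hj
    exact lt_irrefl _ hj
  have h0 := hg.1
  by_cases hex : ∃ σ, g k j σ < g τ (Equiv.swap k τ j) σ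
  · obtain ⟨σ, hσ⟩ := hex
    have hστ : σ ≠ τ := by rintro rfl; exact lt_asymm hj hσ
    obtain ⟨m, hm0, hm1, hm2⟩ : ∃ m : ℝ, 0 < m ∧ m ≤ g k j τ ∧
        m ≤ g τ (Equiv.swap k τ j) σ :=
      ⟨min (g k j τ) (g τ (Equiv.swap k τ j) σ),
        lt_min ((h0 _ _ _).trans_lt hj) ((h0 _ _ _).trans_lt hσ), min_le_left _ _, min_le_right _ _⟩
    have hTz : ∑ ρ, ((if ρ = τ then m else 0) - (if ρ = σ then m else 0)) = 0 := by
      rw [sum_sub_distrib]; simp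
    refine perturbA s c W I hc hI g hg k τ j hkτ hjτ
      (fun ρ => (if ρ = τ then m else 0) - (if ρ = σ then m else 0)) ?_ ?_ hTz.ge (Or.inl hTz) ?_
    · intro ρ
      have := h0 k j ρ
      split_ifs with h1 h2 h2 <;> subst_vars <;> linarith
    · intro ρ
      have := h0 τ (Equiv.swap k τ j) ρ
      split_ifs with h1 h2 h2 <;> subst_vars <;> linarith
    · simp only [hkτ, hστ.symm, if_true, if_false]
      split_ifs <;> linarith
  · push Not at hex
    have hTz : ∑ ρ, (if ρ = τ then g k j τ - g τ (Equiv.swap k τ j) τ else 0)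
        = g k j τ - g τ (Equiv.swap k τ j) τ := by simp
    refine perturbA s c W I hc hI g hg k τ j hkτ hjτ
      (fun ρ => if ρ = τ then g k j τ - g τ (Equiv.swap k τ j) τ else 0) ?_ ?_ ?_ (Or.inr ?_) ?_
    · intro ρ
      have := h0 k j ρ
      have := h0 τ (Equiv.swap k τ j) ρ
      split_ifs with h1 <;> subst_vars <;> linarith
    · intro ρ
      have := h0 τ (Equiv.swap k τ j) ρ
      split_ifs with h1 <;> subst_vars <;> linarith
    · rw [hTz]; linarith
    · rw [hTz, ← sum_sub_distrib]
      exact single_le_sum (f := fun ρ => g k j ρ - g τ (Equiv.swap k τ j) ρ)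
        (fun ρ _ => sub_nonneg.2 (hex ρ)) (mem_univ τ)
    · simp only [hkτ, if_true, if_false]; linarith

/-- With symmetric demand, `θ_i = θ > 0`, and `0 < I < W`, if an optimal tuple exists
then there exists an optimal tuple satisfying the IC constraint `x_τ^τ ≥ x_i^τ` for
all `i, τ`; hence imposing IC causes no loss of revenue and PARM achieves the
full-information first-best revenue. -/
theorem stmt2 {L : Type*} [Fintype L] (θfun : L → ℝ) (α : L → L → ℝ) (s : L → ℝ)
    (W I θ : ℝ)
    (hθ : ∀ i, θfun i = θ) (hθpos : 0 < θ)
    (hα0 : ∀ i j, 0 ≤ α i j) (hα1 : ∀ i j, α i j ≤ 1) (hαsum : ∀ i, (∑ j, α i j) = 1)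
    (hs : ∀ τ, 0 ≤ s τ)
    (hsym : ∀ i j k l, θfun i = θfun k ∧ α i j = α k l)
    (hIpos : 0 < I) (hIW : I < W)
    (hexists : ∃ p f x y, Feasible θfun α s p f x y ∧
      ∀ p' f' x' y', Feasible θfun α s p' f' x' y' →
        Revenue W I p' f' x' ≤ Revenue W I p f x) :
    ∃ p f x y, Feasible θfun α s p f x y ∧
      (∀ i τ, x i τ ≤ x τ τ) ∧
      (∀ p' f' x' y', Feasible θfun α s p' f' x' y' →
        Revenue W I p' f' x' ≤ Revenue W I p f x) := by
  obtain ⟨p, f, x, y, hF, hopt⟩ := hexists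
  rcases isEmpty_or_nonempty L with hL | ⟨⟨i0⟩⟩
  · exact ⟨p, f, x, y, hF, fun i => hL.elim i, hopt⟩
  have hca : ∀ i j, θfun i * α i j = θ * α i0 i0 := by
    intro i j; rw [hθ, (hsym i j i0 i0).2]
  have hα : 0 < α i0 i0 := by
    refine lt_of_le_of_ne (hα0 _ _) fun h => ?_
    have h1 := hαsum i0
    rw [sum_eq_zero fun j _ => ((hsym i0 j i0 i0).2.trans h.symm)] at h1
    exact zero_ne_one h1
  have hc : 0 < θ * α i0 i0 := mul_pos hθpos hα
  obtain ⟨g, hg, hle⟩ := symmA θfun α s W I _ hc hca p f x y hF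
  obtain ⟨p1, f1, y1, hF1, hR1⟩ := constructA θfun α s W I _ hc hca g hg
  refine ⟨p1, f1, _, y1, hF1, ?_, ?_⟩
  · intro i τ
    by_contra! hv
    obtain ⟨g', hg', hlt⟩ := improveA s _ W I hc hIpos g hg i τ hv
    obtain ⟨p2, f2, y2, hF2, hR2⟩ := constructA θfun α s W I _ hc hca g' hg'
    have := hopt _ _ _ _ hF2
    linarith
  · intro p' f' x' y' hF'
    have := hopt _ _ _ _ hF'
    linarith
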